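/- For n ≥ 2 and 1 ≤ j ≤ n-1, the sum over derangements σ of [n] with σ(j) = n of (-1)^{cyc(σ)} · ∏_{i ∈ EXCi(σ)} x_i equals -x₁⋯x_j. -/

import Mathlib

open Finset

/-- Number of cycles of a permutation (counting fixed points as 1-cycles). -/
def cyc {n : ℕ} (σ : Equiv.Perm (Fin n)) : ℕ :=
  σ.cycleType.card + (Finset.univ.filter fun i => σ i = i).card

/-- Set of excedance indices of a permutation. -/
def excIdx {n : ℕ} (σ : Equiv.Perm (Fin n)) : Finset (Fin n) :=
  Finset.univ.filter fun i => i < σ i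

lemma cyc_sign {R : Type*} [CommRing R] {n : ℕ} (σ : Equiv.Perm (Fin n)) :
    (-1 : R) ^ cyc σ = (-1) ^ n * ((Equiv.Perm.sign σ : ℤ) : R) := by
  have h1 : σ.support.card + (Finset.univ.filter fun i => σ i = i).card = n := by
    have := Finset.card_filter_add_card_filter_not (s := (Finset.univ : Finset (Fin n)))
      (fun i => σ i = i)
    have h2 : σ.support = Finset.univ.filter (fun i => ¬ σ i = i) := by
      ext i; simp
    rw [h2, add_comm, this]; simp
  rw [Equiv.Perm.sign_of_cycleType, Equiv.Perm.sum_cycleType]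
  push_cast
  rw [cyc, ← pow_add]
  generalize σ.support.card = a at *
  generalize (Finset.univ.filter fun i => σ i = i).card = b at *
  subst h1
  rw [show a + b + (a + σ.cycleType.card) = 2 * a + (σ.cycleType.card + b) by ring, pow_add _ (2 * a),
    pow_mul]
  simp

/-- The matrix whose determinant expansion is the sum. -/
def matA {R : Type*} [CommRing R] {m : ℕ} (x : Fin (m+1) → R) (J : Fin (m+1)) :
    Matrix (Fin (m+1)) (Fin (m+1)) R :=
  fun i k => if i = J then (if k = Fin.last m then x i else 0) else
    if k = i then 0 else if i < k then x i else 1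

/-- Column differences of `matA`. -/
def matB {R : Type*} [CommRing R] {m : ℕ} (x : Fin (m+1) → R) (J : Fin (m+1)) :
    Matrix (Fin (m+1)) (Fin (m+1)) R :=
  fun i k => if i = J then (if k = Fin.last m then x i else 0) else
    if k.val = i.val + 1 then x i else if i.val = 0 then 0 else
    if k.val = 0 then 1 else if k = i then -1 else 0

lemma det_AB {R : Type*} [CommRing R] {m : ℕ} (x : Fin (m+1) → R) (J : Fin (m+1))
    (hJ : J.val < m) : (matA x J).det = (matB x J).det := by
  apply Matrix.det_eq_of_forall_col_eq_smul_add_pred (fun _ => 1)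
  · intro i
    simp only [matA, matB, Fin.ext_iff, Fin.lt_def, Fin.val_last, Fin.val_zero]
    split_ifs <;> first | contradiction | rfl | omega | simp_all
  · intro i k
    have := k.2
    simp only [matA, matB, Fin.ext_iff, Fin.lt_def, Fin.val_last, Fin.val_succ, Fin.val_castSucc]
    split_ifs <;> first | contradiction | omega | simp

lemma prod_A {R : Type*} [CommRing R] {m : ℕ} (x : Fin (m+1) → R) (J : Fin (m+1))
    (hJ : J.val < m) (σ : Equiv.Perm (Fin (m+1))) :
    ∏ i, matA x J i (σ i) =
      if (∀ i, σ i ≠ i) ∧ σ J = Fin.last m then ∏ i ∈ excIdx σ, x i else 0 := by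
  split_ifs with h
  · obtain ⟨h1, h2⟩ := h
    rw [excIdx, Finset.prod_filter]
    refine Finset.prod_congr rfl fun i _ => ?_
    by_cases hi : i = J
    · subst hi
      have : i < Fin.last m := by simpa [Fin.lt_def] using hJ
      simp [matA, h2, this]
    · simp [matA, hi, h1 i]
  · by_cases h2 : σ J = Fin.last m
    · have : ∃ i, σ i = i := by
        by_contra hc
        push Not at hc
        exact h ⟨hc, h2⟩
      obtain ⟨i, hi⟩ := this
      refine Finset.prod_eq_zero (Finset.mem_univ i) ?_
      have : i ≠ J := by
        rintro rfl
        rw [hi] at h2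
        rw [h2] at hJ
        simp at hJ
      simp [matA, hi, this]
    · refine Finset.prod_eq_zero (Finset.mem_univ J) ?_
      simp [matA, h2]

lemma B_ne {R : Type*} [CommRing R] {m : ℕ} (x : Fin (m+1) → R) (J i k : Fin (m+1))
    (h : matB x J i k ≠ 0) : (i.val = J.val ∧ k.val = m) ∨ (i.val ≠ J.val ∧
      (k.val = i.val + 1 ∨ (i.val ≠ 0 ∧ k.val = 0) ∨ (i.val ≠ 0 ∧ k.val = i.val))) := by
  simp only [matB, Fin.ext_iff, Fin.val_last] at h
  split_ifs at h <;> first | omega | simp at h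

/-- The only permutation contributing to the determinant of `matB`. -/
def permP {m : ℕ} (J : Fin (m+1)) : Equiv.Perm (Fin (m+1)) :=
  Equiv.swap 0 (Fin.last m) * Fin.cycleRange J

lemma permP_val {m : ℕ} (J : Fin (m+1)) (hJ : J.val < m) (i : Fin (m+1)) :
    (permP J i).val = if i.val < J.val then i.val + 1 else if i.val = J.val then m else
      if i.val = m then 0 else i.val := by
  unfold permP
  rw [Equiv.Perm.mul_apply]
  split_ifs with h1 h2 h3
  · have := Fin.coe_cycleRange_of_lt (i := i) (j := J) h1
    rw [Equiv.swap_apply_of_ne_of_ne, this]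
    · rw [ne_eq, Fin.ext_iff, this, Fin.val_zero]; omega
    · rw [ne_eq, Fin.ext_iff, this, Fin.val_last]; omega
  · have : i = J := Fin.ext h2
    subst this
    rw [Fin.cycleRange_self]; simp
  · have : J < i := by rw [Fin.lt_def]; omega
    rw [Fin.cycleRange_of_gt this]
    have : i = Fin.last m := Fin.ext h3
    rw [this]; simp
  · have : J < i := by rw [Fin.lt_def]; omega
    rw [Fin.cycleRange_of_gt this, Equiv.swap_apply_of_ne_of_ne]
    · rw [ne_eq, Fin.ext_iff, Fin.val_zero]; omega
    · rw [ne_eq, Fin.ext_iff, Fin.val_last]; omega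

lemma unique_P {m : ℕ} (J : Fin (m+1)) (hJ : J.val < m) (σ : Equiv.Perm (Fin (m+1)))
    (h : ∀ i : Fin (m+1), (i.val = J.val ∧ (σ i).val = m) ∨ (i.val ≠ J.val ∧
      ((σ i).val = i.val + 1 ∨ (i.val ≠ 0 ∧ (σ i).val = 0) ∨
        (i.val ≠ 0 ∧ (σ i).val = i.val)))) : σ = permP J := by
  have inj : ∀ i k : Fin (m+1), (σ i).val = (σ k).val → i.val = k.val := by
    intro i k hik
    rw [σ.injective (Fin.ext hik)]
  have hσJ : (σ J).val = m := by have := h J; omega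
  have hσN : (σ (Fin.last m)).val = 0 := by
    have h1 := h (Fin.last m)
    have h2 := inj (Fin.last m) J
    have := (σ (Fin.last m)).2
    simp only [Fin.val_last] at *
    omega
  have hup : ∀ a (ha : a < J.val), (σ ⟨a, by omega⟩).val = a + 1 := by
    intro a
    induction a with
    | zero => 
      intro ha
      have := h ⟨0, by omega⟩
      simp only at this
      omega
    | succ a ih =>
      intro ha
      have h0 := ih (by omega)
      have h1 := h ⟨a+1, by omega⟩
      have h2 := inj ⟨a+1, by omega⟩ ⟨a, by omega⟩
      have h3 := inj ⟨a+1, by omega⟩ (Fin.last m)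
      simp only [Fin.val_last] at *
      omega
  have hdn : ∀ d (a : ℕ) (_ : a + d + 1 = m) (_ : J.val < a), (σ ⟨a, by omega⟩).val = a := by
    intro d
    induction d with
    | zero =>
      intro a ha haJ
      have h1 := h ⟨a, by omega⟩
      have h2 := inj ⟨a, by omega⟩ J
      have h3 := inj ⟨a, by omega⟩ (Fin.last m)
      simp only [Fin.val_last] at *
      omega
    | succ d ih =>
      intro a ha haJ
      have h0 := ih (a+1) (by omega) (by omega)
      have h1 := h ⟨a, by omega⟩
      have h2 := inj ⟨a, by omega⟩ ⟨a+1, by omega⟩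
      have h3 := inj ⟨a, by omega⟩ (Fin.last m)
      simp only [Fin.val_last] at *
      omega
  ext i
  rw [permP_val J hJ]
  split_ifs with h1 h2 h3
  · exact hup i.val h1
  · rw [show i = J from Fin.ext h2, hσJ]
  · rw [show i = Fin.last m from Fin.ext h3, hσN]
  · exact hdn (m - 1 - i.val) i.val (by omega) (by omega)

lemma prod_BP {R : Type*} [CommRing R] {m : ℕ} (x : Fin (m+1) → R) (J : Fin (m+1))
    (hJ : J.val < m) : ∏ i, matB x J i (permP J i) =
      (-1) ^ (m - 1 - J.val) * ∏ i ∈ Finset.univ.filter (fun i : Fin (m+1) => i.val < J.val + 1), x i := by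
  have key : ∀ i : Fin (m+1), matB x J i (permP J i) =
      (if i ∈ Finset.Ioo J (Fin.last m) then -1 else 1) * (if i.val < J.val + 1 then x i else 1) := by
    intro i
    have := i.2
    simp only [matB, Fin.ext_iff, permP_val J hJ, Fin.val_last, Finset.mem_Ioo, Fin.lt_def]
    split_ifs <;> first | contradiction | omega | simp
  rw [Finset.prod_congr rfl fun i _ => key i, Finset.prod_mul_distrib, ← Finset.prod_filter,
    ← Finset.prod_filter]
  congr 1
  rw [Finset.prod_const]
  congr 1
  rw [Finset.filter_mem_eq_inter, Finset.univ_inter, Fin.card_Ioo, Fin.val_last]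
  omega

lemma det_B {R : Type*} [CommRing R] {m : ℕ} (x : Fin (m+1) → R) (J : Fin (m+1))
    (hJ : J.val < m) : (matB x J).det =
      (-1) ^ m * ∏ i ∈ Finset.univ.filter (fun i : Fin (m+1) => i.val < J.val + 1), x i := by
  rw [← Matrix.det_transpose, Matrix.det_apply', Finset.sum_eq_single (permP J)]
  · simp only [Matrix.transpose_apply]
    rw [prod_BP x J hJ, ← mul_assoc]
    congr 1
    have : (0 : Fin (m+1)) ≠ Fin.last m := by
      rw [ne_eq, Fin.ext_iff, Fin.val_last, Fin.val_zero]; omega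
    rw [permP, Equiv.Perm.sign_mul, Equiv.Perm.sign_swap this, Fin.sign_cycleRange]
    push_cast
    obtain ⟨d, hd⟩ : ∃ d, m = J.val + 1 + d := ⟨m - J.val - 1, by omega⟩
    rw [show m - 1 - J.val = d by omega]
    conv_rhs => rw [hd]
    ring
  · intro σ _ hσ
    by_cases hz : ∃ i, matB x J i (σ i) = 0
    · obtain ⟨i, hi⟩ := hz
      rw [Finset.prod_eq_zero (Finset.mem_univ i) (by simpa using hi), mul_zero]
    · push Not at hz
      exact absurd (unique_P J hJ σ fun i => B_ne x J i _ (hz i)) hσ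
  · simp

/-- With `Fin n` representing `[n]` 0-based, `σ ⟨j-1⟩ = ⟨n-1⟩` encodes
`σ(j) = n`, and `x i` is `x_{i+1}`. -/
theorem stmt8 {R : Type*} [CommRing R] (n j : ℕ) (x : Fin n → R)
    (hn : 2 ≤ n) (hj1 : 1 ≤ j) (hj2 : j ≤ n - 1) :
    ∑ σ ∈ Finset.univ.filter (fun σ : Equiv.Perm (Fin n) =>
        (∀ i, σ i ≠ i) ∧ σ ⟨j - 1, by omega⟩ = ⟨n - 1, by omega⟩),
      (-1 : R) ^ cyc σ * ∏ i ∈ excIdx σ, x i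
    = -∏ i ∈ Finset.univ.filter (fun i : Fin n => i.val < j), x i := by
  obtain ⟨m, rfl⟩ : ∃ m, n = m + 1 := ⟨n - 1, by omega⟩
  obtain ⟨a, rfl⟩ : ∃ a, j = a + 1 := ⟨j - 1, by omega⟩
  have ha : a < m := by omega
  set J : Fin (m+1) := ⟨a, by omega⟩ with hJdef
  have hJ : J.val < m := ha
  have h := det_AB x J hJ
  rw [det_B x J hJ, ← Matrix.det_transpose, Matrix.det_apply'] at h
  simp only [Matrix.transpose_apply, prod_A x J hJ] at h
  rw [Finset.sum_filter]
  have : ∀ σ : Equiv.Perm (Fin (m+1)),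
      (if (∀ i, σ i ≠ i) ∧ σ ⟨a + 1 - 1, by omega⟩ = ⟨m + 1 - 1, by omega⟩ then
        (-1 : R) ^ cyc σ * ∏ i ∈ excIdx σ, x i else 0) =
      (-1) ^ (m+1) * (((Equiv.Perm.sign σ : ℤ) : R) *
        if (∀ i, σ i ≠ i) ∧ σ J = Fin.last m then ∏ i ∈ excIdx σ, x i else 0) := by
    intro σ
    have e : (σ ⟨a + 1 - 1, by omega⟩ = ⟨m + 1 - 1, by omega⟩) ↔ σ J = Fin.last m := Iff.rfl
    simp only [e]
    split_ifs
    · rw [cyc_sign]; ring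
    · simp
  rw [Finset.sum_congr rfl fun σ _ => this σ, ← Finset.mul_sum, h, ← mul_assoc, ← pow_add,
    show m + 1 + m = 2 * m + 1 by ring, pow_succ, pow_mul]
  simp [hJdef]
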